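/- In Version B, a position with exactly six piles is a P-position if and only if its multiset of pile sizes has one of the following forms: (1) {1, 1, 1, 1, a, b} with a, b even; (2) {1, 1, a, b, c, d} with a, b, c, d even; (3) {1, 1, a, b, c, d} with a even and b, c, d odd, b, c, d ≥ 3; (4) {1, 2, a, b, c, d} with a, b, c even, a, b, c ≥ 4, and d odd, d ≥ 3; (5) {1, 3, a, b, c, d} with a, b even, a, b ≥ 6, and c, d odd, c, d ≥ 5; (6) {2, 3, a, b, c, d} with a, b, c even, a, b, c ≥ 6, and d odd, d ≥ 5; (7) {2, a, b, c, d, e} with a, b even and c, d, e odd, c, d, e ≥ 3 — except for the positions of the form {2, 3, a, b, c, d} with a, b even, a, b ≥ 6, and c, d odd, c, d ≥ 5, which are N-positions; (8) all six pile sizes even; (9) four pile sizes even, each at least 4, and two odd, each at least 3; (10) exactly one pile size even and the other five odd, each odd pile of size at least 3. -/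

import Mathlib

/-- Remove one token from a pile of size `p` in `G`: delete one copy of `p` and,
if `p ≠ 1`, add back a pile of size `p - 1`. -/
def takeOne (G : Multiset ℕ) (p : ℕ) : Multiset ℕ :=
  G.erase p + (if p = 1 then (0 : Multiset ℕ) else {p - 1})

/-- Legal moves of Version B: remove one token from one chosen pile, or remove
one token from every pile simultaneously (piles reaching size 0 are deleted). -/
inductive MoveB : Multiset ℕ → Multiset ℕ → Prop
  | one {G : Multiset ℕ} {p : ℕ} (hp : p ∈ G) (h1 : 1 ≤ p) : MoveB G (takeOne G p)
  | all {G : Multiset ℕ} (hG : G ≠ 0) : MoveB G ((G.map (· - 1)).filter (· ≠ 0))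

mutual
  /-- P-positions of Version B under normal play: every move leads to an N-position
  (in particular the empty position is a P-position).  Since every move strictly
  decreases the total number of tokens, this inductive definition agrees with the
  usual recursive definition of outcome classes. -/
  inductive PPosB : Multiset ℕ → Prop
    | mk : ∀ {G : Multiset ℕ}, (∀ H, MoveB G H → NPosB H) → PPosB G
  /-- N-positions of Version B under normal play: some move leads to a P-position. -/
  inductive NPosB : Multiset ℕ → Prop
    | mk : ∀ {G H : Multiset ℕ}, MoveB G H → PPosB H → NPosB G
end

/-- Arithmetic description of the P-positions with at most six piles: `n₁`, …, `n₄` count the piles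
of size `1`, …, `4`, while `e` counts the even piles and `o` the odd piles of size at least `3`. -/
def PPattern (n₁ n₂ n₃ n₄ e o : ℕ) : Prop :=
  (n₁ = 0 ∧ (o = 0 ∨ (e = 1 ∧ 2 ≤ o) ∨ (e = 3 ∧ o = 2 ∧ ¬ (n₂ = 1 ∧ n₃ = 0)) ∨
    (e = 3 ∧ o = 3 ∧ n₂ ≠ 0 ∧ ¬ (n₂ = 1 ∧ n₃ = 1 ∧ n₄ = 0)) ∨
    (e = 4 ∧ o = 2 ∧ (n₂ = 0 ∨ (n₂ = 1 ∧ n₃ = 1 ∧ n₄ = 0))))) ∨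
  (n₁ = 1 ∧ ((e = 1 ∧ o = 1) ∨ (e = 2 ∧ o = 2 ∧ n₂ = 0 ∧ n₃ = 0) ∨ (e = 3 ∧ o = 1 ∧ n₂ ≠ 0) ∨
    (e = 2 ∧ o = 3 ∧ n₂ = 0 ∧ n₃ = 1 ∧ n₄ = 0) ∨ (e = 4 ∧ o = 1 ∧ n₂ = 1))) ∨
  (n₁ = 2 ∧ ((o = 0 ∧ e ≠ 0) ∨ (e = 1 ∧ 2 ≤ o))) ∨
  (n₁ = 3 ∧ e = 1 ∧ o = 1) ∨
  (n₁ = 4 ∧ o = 0 ∧ e ≠ 0)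

set_option synthInstance.maxSize 1000 in
instance (n₁ n₂ n₃ n₄ e o : ℕ) : Decidable (PPattern n₁ n₂ n₃ n₄ e o) := by
  unfold PPattern
  infer_instance

/-- Some move leads to a pattern of a P-position; `n₅`, `m₆`, `m₇` count the piles of size `5`, the
even piles of size at least `6` and the odd piles of size at least `7`. -/
def MovesToPPattern (n₁ n₂ n₃ n₄ n₅ m₆ m₇ e o : ℕ) : Prop :=
  (n₁ ≠ 0 ∧ PPattern (n₁ - 1) n₂ n₃ n₄ e o) ∨
  (n₂ ≠ 0 ∧ PPattern (n₁ + 1) (n₂ - 1) n₃ n₄ (e - 1) o) ∨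
  (n₃ ≠ 0 ∧ PPattern n₁ (n₂ + 1) (n₃ - 1) n₄ (e + 1) (o - 1)) ∨
  (n₄ ≠ 0 ∧ PPattern n₁ n₂ (n₃ + 1) (n₄ - 1) (e - 1) (o + 1)) ∨
  (n₅ ≠ 0 ∧ PPattern n₁ n₂ n₃ (n₄ + 1) (e + 1) (o - 1)) ∨
  (m₆ ≠ 0 ∧ PPattern n₁ n₂ n₃ n₄ (e - 1) (o + 1)) ∨
  (m₇ ≠ 0 ∧ PPattern n₁ n₂ n₃ n₄ (e + 1) (o - 1)) ∨
  (n₁ + e + o ≠ 0 ∧ PPattern n₂ n₃ n₄ n₅ o (e - n₂))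

instance (n₁ n₂ n₃ n₄ n₅ m₆ m₇ e o : ℕ) :
    Decidable (MovesToPPattern n₁ n₂ n₃ n₄ n₅ m₆ m₇ e o) := by
  unfold MovesToPPattern
  infer_instance

set_option maxRecDepth 100000 in
set_option synthInstance.maxSize 1000 in
theorem pPattern_iff_not_movesToPPattern :
    ∀ n₁ < 7, ∀ n₂ < 7 - n₁, ∀ n₃ < 7 - (n₁ + n₂), ∀ n₄ < 7 - (n₁ + n₂ + n₃),
    ∀ n₅ < 7 - (n₁ + n₂ + n₃ + n₄), ∀ m₆ < 7 - (n₁ + n₂ + n₃ + n₄ + n₅),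
    ∀ m₇ < 7 - (n₁ + n₂ + n₃ + n₄ + n₅ + m₆),
      PPattern n₁ n₂ n₃ n₄ (n₂ + n₄ + m₆) (n₃ + n₅ + m₇) ↔
        ¬ MovesToPPattern n₁ n₂ n₃ n₄ n₅ m₆ m₇ (n₂ + n₄ + m₆) (n₃ + n₅ + m₇) := by
  decide +kernel

/-- The number of odd piles of size at least `3`. -/
def bigOdds (G : Multiset ℕ) : ℕ :=
  G.countP fun x => Odd x ∧ 3 ≤ x

@[simp]
theorem bigOdds_cons (p : ℕ) (H : Multiset ℕ) :
    bigOdds (p ::ₘ H) = bigOdds H + if Odd p ∧ 3 ≤ p then 1 else 0 :=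
  Multiset.countP_cons ..

@[simp]
theorem bigOdds_zero : bigOdds 0 = 0 :=
  rfl

/-- The position `G` has the pattern of a P-position. -/
def HasPPattern (G : Multiset ℕ) : Prop :=
  PPattern (G.count 1) (G.count 2) (G.count 3) (G.count 4) (G.countP Even) (bigOdds G)

/-- The result of removing one token from every pile. -/
abbrev takeAll (G : Multiset ℕ) : Multiset ℕ :=
  (G.map (· - 1)).filter (· ≠ 0)

theorem zero_notMem_takeOne_cons {p : ℕ} {H : Multiset ℕ} (h : 0 ∉ p ::ₘ H) :
    0 ∉ takeOne (p ::ₘ H) p := by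
  simp only [Multiset.mem_cons, not_or] at h
  unfold takeOne
  split_ifs <;> simp <;> grind

theorem countP_takeOne_cons (P : ℕ → Prop) [DecidablePred P] (p : ℕ) (H : Multiset ℕ) :
    (takeOne (p ::ₘ H) p).countP P = H.countP P + if P (p - 1) ∧ p ≠ 1 then 1 else 0 := by
  unfold takeOne
  by_cases h : p = 1
  · simp [h]
  · simp [h, ← Multiset.cons_zero, Multiset.countP_cons]

theorem card_takeOne_cons_le (p : ℕ) (H : Multiset ℕ) :
    (takeOne (p ::ₘ H) p).card ≤ (p ::ₘ H).card := by
  unfold takeOne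
  split_ifs <;> simp

theorem sum_takeOne_cons_lt {p : ℕ} (hp : p ≠ 0) (H : Multiset ℕ) :
    (takeOne (p ::ₘ H) p).sum < (p ::ₘ H).sum := by
  unfold takeOne
  split_ifs <;> simp <;> omega

theorem countP_takeAll (P : ℕ → Prop) [DecidablePred P] (G : Multiset ℕ) :
    (takeAll G).countP P = G.countP fun x => P (x - 1) ∧ x - 1 ≠ 0 := by
  rw [takeAll, Multiset.countP_filter, Multiset.countP_map, Multiset.countP_eq_card_filter]

theorem card_takeAll_le (G : Multiset ℕ) : (takeAll G).card ≤ G.card :=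
  (Multiset.card_le_card (Multiset.filter_le _ _)).trans (Multiset.card_map _ _).le

theorem sum_takeAll_le (G : Multiset ℕ) : (takeAll G).sum ≤ G.sum := by
  induction G using Multiset.induction_on with
  | empty => simp [takeAll]
  | cons p H ih =>
    rw [takeAll, Multiset.map_cons, Multiset.filter_cons]
    split_ifs <;> simp [takeAll] at ih ⊢ <;> omega

theorem sum_takeAll_lt {G : Multiset ℕ} (hG : 0 ∉ G) (h : G ≠ 0) : (takeAll G).sum < G.sum := by
  obtain ⟨p, hp⟩ := Multiset.exists_mem_of_ne_zero h
  obtain ⟨H, rfl⟩ := Multiset.exists_cons_of_mem hp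
  have hp0 : p ≠ 0 := fun h => hG (h ▸ hp)
  have ih := sum_takeAll_le H
  rw [takeAll, Multiset.map_cons, Multiset.filter_cons]
  split_ifs <;> simp [takeAll] at ih ⊢ <;> omega

theorem countP_even_eq (G : Multiset ℕ) (hG : 0 ∉ G) :
    G.countP Even = G.count 2 + G.count 4 + G.countP fun x => Even x ∧ 6 ≤ x := by
  induction G using Multiset.induction_on with
  | empty => simp
  | cons p H ih =>
    simp only [Multiset.mem_cons, not_or] at hG
    simp only [Multiset.countP_cons, Multiset.count_cons, ih hG.2]
    grind

theorem bigOdds_eq (G : Multiset ℕ) :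
    bigOdds G = G.count 3 + G.count 5 + G.countP fun x => Odd x ∧ 7 ≤ x := by
  induction G using Multiset.induction_on with
  | empty => simp
  | cons p H ih =>
    simp only [bigOdds_cons, Multiset.countP_cons, Multiset.count_cons, ih]
    grind

theorem card_eq_count_add (G : Multiset ℕ) (hG : 0 ∉ G) :
    G.card = G.count 1 + G.countP Even + bigOdds G := by
  induction G using Multiset.induction_on with
  | empty => simp
  | cons p H ih =>
    simp only [Multiset.mem_cons, not_or] at hG
    simp only [bigOdds_cons, Multiset.countP_cons, Multiset.count_cons, Multiset.card_cons, ih hG.2]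
    grind

theorem hasPPattern_takeAll (G : Multiset ℕ) (hG : 0 ∉ G) :
    HasPPattern (takeAll G) ↔ PPattern (G.count 2) (G.count 3) (G.count 4) (G.count 5) (bigOdds G)
      (G.countP Even - G.count 2) := by
  have h (n : ℕ) (hn : n ≠ 0) : (takeAll G).count n = G.count (n + 1) := by
    rw [Multiset.count, countP_takeAll]
    exact Multiset.countP_congr rfl fun x _ => by grind
  have he : (takeAll G).countP Even = bigOdds G := by
    rw [countP_takeAll]
    exact Multiset.countP_congr rfl fun x _ => by grind
  have ho : bigOdds (takeAll G) = G.countP Even - G.count 2 := by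
    have : bigOdds (takeAll G) = G.count 4 + G.countP fun x => Even x ∧ 6 ≤ x := by
      rw [bigOdds, countP_takeAll]
      clear h he hG
      induction G using Multiset.induction_on with
      | empty => simp
      | cons p H ih => grind [Multiset.countP_cons, Multiset.count_cons]
    rw [this, countP_even_eq G hG]
    omega
  rw [HasPPattern, h 1 one_ne_zero, h 2 two_ne_zero, h 3 three_ne_zero, h 4 four_ne_zero, he, ho]

theorem hasPPattern_takeOne_cons {p : ℕ} (hp : p ≠ 0) (H : Multiset ℕ) :
    HasPPattern (takeOne (p ::ₘ H) p) ↔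
      PPattern (H.count 1 + if p = 2 then 1 else 0) (H.count 2 + if p = 3 then 1 else 0)
        (H.count 3 + if p = 4 then 1 else 0) (H.count 4 + if p = 5 then 1 else 0)
        (H.countP Even + if Odd p ∧ 3 ≤ p then 1 else 0)
        (bigOdds H + if Even p ∧ 4 ≤ p then 1 else 0) := by
  have h (n : ℕ) (hn : n ≠ 0) :
      (takeOne (p ::ₘ H) p).count n = H.count n + if p = n + 1 then 1 else 0 := by
    refine (countP_takeOne_cons (n = ·) p H).trans ?_
    rw [Multiset.count]
    grind
  have he : (takeOne (p ::ₘ H) p).countP Even =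
      H.countP Even + if Odd p ∧ 3 ≤ p then 1 else 0 := by
    rw [countP_takeOne_cons]
    grind
  have ho : bigOdds (takeOne (p ::ₘ H) p) = bigOdds H + if Even p ∧ 4 ≤ p then 1 else 0 := by
    rw [bigOdds, countP_takeOne_cons, bigOdds]
    grind
  rw [HasPPattern, h 1 one_ne_zero, h 2 two_ne_zero, h 3 three_ne_zero, h 4 four_ne_zero, he, ho]

theorem exists_moveB_iff (G : Multiset ℕ) (hG : 0 ∉ G) :
    (∃ H, MoveB G H ∧ HasPPattern H) ↔
      MovesToPPattern (G.count 1) (G.count 2) (G.count 3) (G.count 4) (G.count 5)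
        (G.countP fun x => Even x ∧ 6 ≤ x) (G.countP fun x => Odd x ∧ 7 ≤ x)
        (G.countP Even) (bigOdds G) := by
  have h1 (h : 1 ∈ G) :
      HasPPattern (takeOne G 1) ↔ PPattern (G.count 1 - 1) (G.count 2) (G.count 3) (G.count 4)
        (G.countP Even) (bigOdds G) := by
    obtain ⟨H, rfl⟩ := Multiset.exists_cons_of_mem h
    rw [hasPPattern_takeOne_cons (by omega)]
    congr! 1 <;> simp only [bigOdds_cons, Multiset.count_cons, Multiset.countP_cons] <;> grind
  have h2 (h : 2 ∈ G) :
      HasPPattern (takeOne G 2) ↔ PPattern (G.count 1 + 1) (G.count 2 - 1) (G.count 3) (G.count 4)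
        (G.countP Even - 1) (bigOdds G) := by
    obtain ⟨H, rfl⟩ := Multiset.exists_cons_of_mem h
    rw [hasPPattern_takeOne_cons (by omega)]
    congr! 1 <;> simp only [bigOdds_cons, Multiset.count_cons, Multiset.countP_cons] <;> grind
  have h3 (h : 3 ∈ G) :
      HasPPattern (takeOne G 3) ↔ PPattern (G.count 1) (G.count 2 + 1) (G.count 3 - 1) (G.count 4)
        (G.countP Even + 1) (bigOdds G - 1) := by
    obtain ⟨H, rfl⟩ := Multiset.exists_cons_of_mem h
    rw [hasPPattern_takeOne_cons (by omega)]
    congr! 1 <;> simp only [bigOdds_cons, Multiset.count_cons, Multiset.countP_cons] <;> grind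
  have h4 (h : 4 ∈ G) :
      HasPPattern (takeOne G 4) ↔ PPattern (G.count 1) (G.count 2) (G.count 3 + 1) (G.count 4 - 1)
        (G.countP Even - 1) (bigOdds G + 1) := by
    obtain ⟨H, rfl⟩ := Multiset.exists_cons_of_mem h
    rw [hasPPattern_takeOne_cons (by omega)]
    congr! 1 <;> simp only [bigOdds_cons, Multiset.count_cons, Multiset.countP_cons] <;> grind
  have h5 (h : 5 ∈ G) :
      HasPPattern (takeOne G 5) ↔ PPattern (G.count 1) (G.count 2) (G.count 3) (G.count 4 + 1)
        (G.countP Even + 1) (bigOdds G - 1) := by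
    obtain ⟨H, rfl⟩ := Multiset.exists_cons_of_mem h
    rw [hasPPattern_takeOne_cons (by omega)]
    congr! 1 <;> simp only [bigOdds_cons, Multiset.count_cons, Multiset.countP_cons] <;> grind
  have he {p : ℕ} (h : p ∈ G) (hp : Even p) (hp' : 6 ≤ p) :
      HasPPattern (takeOne G p) ↔ PPattern (G.count 1) (G.count 2) (G.count 3) (G.count 4)
        (G.countP Even - 1) (bigOdds G + 1) := by
    obtain ⟨H, rfl⟩ := Multiset.exists_cons_of_mem h
    rw [hasPPattern_takeOne_cons (by omega)]
    congr! 1 <;> simp only [bigOdds_cons, Multiset.count_cons, Multiset.countP_cons] <;> grind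
  have ho {p : ℕ} (h : p ∈ G) (hp : Odd p) (hp' : 7 ≤ p) :
      HasPPattern (takeOne G p) ↔ PPattern (G.count 1) (G.count 2) (G.count 3) (G.count 4)
        (G.countP Even + 1) (bigOdds G - 1) := by
    obtain ⟨H, rfl⟩ := Multiset.exists_cons_of_mem h
    rw [hasPPattern_takeOne_cons (by omega)]
    congr! 1 <;> simp only [bigOdds_cons, Multiset.count_cons, Multiset.countP_cons] <;> grind
  have ha := hasPPattern_takeAll G hG
  have hcard := card_eq_count_add G hG
  have hne : G ≠ 0 ↔ G.count 1 + G.countP Even + bigOdds G ≠ 0 := by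
    rw [← hcard, ne_eq, ne_eq, Multiset.card_eq_zero]
  simp only [MovesToPPattern, Multiset.count_ne_zero, ne_eq, Multiset.countP_eq_zero, ← hne]
  push Not
  constructor
  · rintro ⟨_, h, hH⟩
    cases h with
    | @one p hp hp1 =>
      obtain rfl | rfl | rfl | rfl | rfl | ⟨h, h'⟩ | ⟨h, h'⟩ : p = 1 ∨ p = 2 ∨ p = 3 ∨ p = 4 ∨
          p = 5 ∨ (Even p ∧ 6 ≤ p) ∨ (Odd p ∧ 7 ≤ p) := by grind
      all_goals grind
    | all h => grind
  · rintro (⟨h, hP⟩ | ⟨h, hP⟩ | ⟨h, hP⟩ | ⟨h, hP⟩ | ⟨h, hP⟩ | ⟨⟨p, hp, h, h'⟩, hP⟩ |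
      ⟨⟨p, hp, h, h'⟩, hP⟩ | ⟨h, hP⟩)
    · exact ⟨_, .one h (by omega), (h1 h).2 hP⟩
    · exact ⟨_, .one h (by omega), (h2 h).2 hP⟩
    · exact ⟨_, .one h (by omega), (h3 h).2 hP⟩
    · exact ⟨_, .one h (by omega), (h4 h).2 hP⟩
    · exact ⟨_, .one h (by omega), (h5 h).2 hP⟩
    · exact ⟨_, .one hp (by omega), (he hp h h').2 hP⟩
    · exact ⟨_, .one hp (by omega), (ho hp h h').2 hP⟩
    · exact ⟨_, .all h, ha.2 hP⟩

theorem hasPPattern_iff_forall_moveB (G : Multiset ℕ) (hG : 0 ∉ G) (hcard : G.card ≤ 6) :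
    HasPPattern G ↔ ∀ H, MoveB G H → ¬ HasPPattern H := by
  have h1 := countP_even_eq G hG
  have h2 := bigOdds_eq G
  have h3 := card_eq_count_add G hG
  have key := pPattern_iff_not_movesToPPattern (G.count 1) (by omega) (G.count 2) (by omega)
    (G.count 3) (by omega) (G.count 4) (by omega) (G.count 5) (by omega)
    (G.countP fun x => Even x ∧ 6 ≤ x) (by omega) (G.countP fun x => Odd x ∧ 7 ≤ x) (by omega)
  rw [← h1, ← h2, ← exists_moveB_iff G hG] at key
  simpa [HasPPattern] using key

theorem MoveB.zero_notMem {G H : Multiset ℕ} (h : MoveB G H) (hG : 0 ∉ G) : 0 ∉ H := by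
  cases h with
  | one hp h1 =>
    obtain ⟨H, rfl⟩ := Multiset.exists_cons_of_mem hp
    exact zero_notMem_takeOne_cons hG
  | all h => simp

theorem MoveB.card_le {G H : Multiset ℕ} (h : MoveB G H) : H.card ≤ G.card := by
  cases h with
  | one hp h1 =>
    obtain ⟨H, rfl⟩ := Multiset.exists_cons_of_mem hp
    exact card_takeOne_cons_le _ H
  | all h => exact card_takeAll_le G

theorem MoveB.sum_lt {G H : Multiset ℕ} (h : MoveB G H) (hG : 0 ∉ G) : H.sum < G.sum := by
  cases h with
  | one hp h1 =>
    obtain ⟨H, rfl⟩ := Multiset.exists_cons_of_mem hp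
    exact sum_takeOne_cons_lt (by omega) H
  | all h => exact sum_takeAll_lt hG h

theorem pPosB_iff_forall (G : Multiset ℕ) : PPosB G ↔ ∀ H, MoveB G H → NPosB H :=
  ⟨fun ⟨h⟩ => h, .mk⟩

theorem nPosB_iff_exists (G : Multiset ℕ) : NPosB G ↔ ∃ H, MoveB G H ∧ PPosB H :=
  ⟨fun ⟨h, h'⟩ => ⟨_, h, h'⟩, fun ⟨_, h, h'⟩ => .mk h h'⟩

theorem pPosB_iff_and_nPosB_iff (G : Multiset ℕ) (hG : 0 ∉ G) (hcard : G.card ≤ 6) :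
    (PPosB G ↔ HasPPattern G) ∧ (NPosB G ↔ ¬ HasPPattern G) := by
  have ih H (h : MoveB G H) :=
    pPosB_iff_and_nPosB_iff H (h.zero_notMem hG) (h.card_le.trans hcard)
  have key := hasPPattern_iff_forall_moveB G hG hcard
  rw [pPosB_iff_forall, nPosB_iff_exists]
  grind
termination_by G.sum
decreasing_by exact h.sum_lt hG

theorem exists_eq_replicate_add (G : Multiset ℕ) (hG : 0 ∉ G) :
    ∃ B C, G = .replicate (G.count 1) 1 + B + C ∧ B.card = G.countP Even ∧ C.card = bigOdds G ∧
      (∀ x ∈ B, Even x ∧ x ∈ G) ∧ ∀ x ∈ C, Odd x ∧ 3 ≤ x ∧ x ∈ G := by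
  refine ⟨G.filter Even, G.filter fun x => Odd x ∧ 3 ≤ x, ?_,
    (Multiset.countP_eq_card_filter ..).symm, (Multiset.countP_eq_card_filter ..).symm,
    by simp; grind, by simp; grind⟩
  induction G using Multiset.induction_on with
  | empty => simp
  | cons p H ih =>
    simp only [Multiset.mem_cons, not_or] at hG
    obtain rfl | hp | hp : p = 1 ∨ Even p ∨ (Odd p ∧ 3 ≤ p) := by grind
    all_goals
      conv_lhs => rw [ih hG.2]
    · simp [Multiset.replicate_succ]
    · simp [hp, Multiset.count_cons_of_ne (show 1 ≠ p by grind), show ¬ Odd p by grind]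
    · simp [hp, Multiset.count_cons_of_ne (show 1 ≠ p by grind), show ¬ Even p by grind]

theorem exists_cons_of_card_eq_succ {B : Multiset ℕ} {n : ℕ} (h : B.card = n + 1) :
    ∃ a C, B = a ::ₘ C ∧ C.card = n := by
  obtain ⟨a, ha⟩ := Multiset.card_pos_iff_exists_mem.1 (by omega : 0 < B.card)
  obtain ⟨C, rfl⟩ := Multiset.exists_cons_of_mem ha
  exact ⟨a, C, rfl, by simpa using h⟩

theorem card_eq_four {B : Multiset ℕ} (h : B.card = 4) : ∃ a b c d, B = {a, b, c, d} := by
  obtain ⟨a, C, rfl, hC⟩ := exists_cons_of_card_eq_succ h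
  obtain ⟨b, c, d, rfl⟩ := Multiset.card_eq_three.1 hC
  exact ⟨a, b, c, d, rfl⟩

theorem card_eq_five {B : Multiset ℕ} (h : B.card = 5) : ∃ a b c d e, B = {a, b, c, d, e} := by
  obtain ⟨a, C, rfl, hC⟩ := exists_cons_of_card_eq_succ h
  obtain ⟨b, c, d, e, rfl⟩ := card_eq_four hC
  exact ⟨a, b, c, d, e, rfl⟩

theorem exists_four_ones_iff {G : Multiset ℕ} (hG : 0 ∉ G) (hcard : G.card = 6) :
    (∃ a b, Even a ∧ Even b ∧
      G = {1, 1, 1, 1, a, b}) ↔ G.count 1 = 4 ∧ G.countP Even = 2 := by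
  constructor
  · rintro ⟨a, b, h⟩
    simp only [h, Multiset.insert_eq_cons, ← Multiset.cons_zero, Multiset.count_cons,
      Multiset.countP_cons, Multiset.count_zero, Multiset.countP_zero]
    and_intros <;> grind
  · intro h
    have hsum := card_eq_count_add G hG
    obtain ⟨B, C, hBC, hB, hC, hB', hC'⟩ := exists_eq_replicate_add G hG
    rw [show G.count 1 = 4 by omega] at hBC
    obtain ⟨a, b, rfl⟩ := Multiset.card_eq_two.1 (show B.card = 2 by omega)
    obtain rfl := Multiset.card_eq_zero.1 (show C.card = 0 by omega)
    simp only [Multiset.insert_eq_cons, Multiset.mem_cons, Multiset.mem_singleton,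
      forall_eq_or_imp, forall_eq] at hB'
    refine ⟨a, b, ?_⟩
    and_intros
    on_goal 3 =>
      rw [hBC]
      rfl
    all_goals
      clear hBC
      grind

theorem exists_two_ones_four_even_iff {G : Multiset ℕ} (hG : 0 ∉ G) (hcard : G.card = 6) :
    (∃ a b c d, Even a ∧ Even b ∧ Even c ∧ Even d ∧
      G = {1, 1, a, b, c, d}) ↔ G.count 1 = 2 ∧ G.countP Even = 4 := by
  constructor
  · rintro ⟨a, b, c, d, h⟩
    simp only [h, Multiset.insert_eq_cons, ← Multiset.cons_zero, Multiset.count_cons,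
      Multiset.countP_cons, Multiset.count_zero, Multiset.countP_zero]
    and_intros <;> grind
  · intro h
    have hsum := card_eq_count_add G hG
    obtain ⟨B, C, hBC, hB, hC, hB', hC'⟩ := exists_eq_replicate_add G hG
    rw [show G.count 1 = 2 by omega] at hBC
    obtain ⟨a, b, c, d, rfl⟩ := card_eq_four (show B.card = 4 by omega)
    obtain rfl := Multiset.card_eq_zero.1 (show C.card = 0 by omega)
    simp only [Multiset.insert_eq_cons, Multiset.mem_cons, Multiset.mem_singleton,
      forall_eq_or_imp, forall_eq] at hB'
    refine ⟨a, b, c, d, ?_⟩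
    and_intros
    on_goal 5 =>
      rw [hBC]
      rfl
    all_goals
      clear hBC
      grind

theorem exists_two_ones_one_even_iff {G : Multiset ℕ} (hG : 0 ∉ G) :
    (∃ a b c d, Even a ∧ Odd b ∧ Odd c ∧ Odd d ∧ 3 ≤ b ∧ 3 ≤ c ∧ 3 ≤ d ∧
      G = {1, 1, a, b, c, d}) ↔ G.count 1 = 2 ∧ G.countP Even = 1 ∧ bigOdds G = 3 := by
  constructor
  · rintro ⟨a, b, c, d, h⟩
    simp only [h, bigOdds_cons, bigOdds_zero, Multiset.insert_eq_cons, ← Multiset.cons_zero,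
      Multiset.count_cons, Multiset.countP_cons, Multiset.count_zero, Multiset.countP_zero]
    and_intros <;> grind
  · intro h
    have hsum := card_eq_count_add G hG
    obtain ⟨B, C, hBC, hB, hC, hB', hC'⟩ := exists_eq_replicate_add G hG
    rw [show G.count 1 = 2 by omega] at hBC
    obtain ⟨a, rfl⟩ := Multiset.card_eq_one.1 (show B.card = 1 by omega)
    obtain ⟨b, c, d, rfl⟩ := Multiset.card_eq_three.1 (show C.card = 3 by omega)
    simp only [Multiset.insert_eq_cons, Multiset.mem_cons, Multiset.mem_singleton,
      forall_eq_or_imp, forall_eq] at hB' hC'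
    refine ⟨a, b, c, d, ?_⟩
    and_intros
    on_goal 8 =>
      rw [hBC]
      rfl
    all_goals
      clear hBC
      grind

theorem exists_one_two_iff {G : Multiset ℕ} (hG : 0 ∉ G) (hcard : G.card = 6) :
    (∃ a b c d, Even a ∧ Even b ∧ Even c ∧ 4 ≤ a ∧ 4 ≤ b ∧ 4 ≤ c ∧ Odd d ∧ 3 ≤ d ∧
      G = {1, 2, a, b, c, d}) ↔
      G.count 1 = 1 ∧ G.count 2 = 1 ∧ G.countP Even = 4 ∧ bigOdds G = 1 := by
  constructor
  · rintro ⟨a, b, c, d, h⟩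
    simp only [h, bigOdds_cons, bigOdds_zero, Multiset.insert_eq_cons, ← Multiset.cons_zero,
      Multiset.count_cons, Multiset.countP_cons, Multiset.count_zero, Multiset.countP_zero]
    and_intros <;> grind
  · intro h
    have hsum := card_eq_count_add G hG
    obtain ⟨G, rfl⟩ := Multiset.exists_cons_of_mem (Multiset.count_ne_zero.1 (by omega) : 2 ∈ G)
    simp at h hsum hcard hG
    obtain ⟨B, C, hBC, hB, hC, hB', hC'⟩ := exists_eq_replicate_add G (by simpa using hG)
    rw [show G.count 1 = 1 by omega] at hBC
    obtain ⟨a, b, c, rfl⟩ := Multiset.card_eq_three.1 (show B.card = 3 by omega)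
    obtain ⟨d, rfl⟩ := Multiset.card_eq_one.1 (show C.card = 1 by omega)
    simp only [Multiset.insert_eq_cons, Multiset.mem_cons, Multiset.mem_singleton,
      forall_eq_or_imp, forall_eq] at hB' hC'
    refine ⟨a, b, c, d, ?_⟩
    and_intros
    on_goal 9 =>
      rw [hBC]
      exact Multiset.cons_swap 2 1 {a, b, c, d}
    all_goals
      clear hBC
      grind

theorem exists_one_three_iff {G : Multiset ℕ} (hG : 0 ∉ G) (hcard : G.card = 6) :
    (∃ a b c d, Even a ∧ Even b ∧ 6 ≤ a ∧ 6 ≤ b ∧ Odd c ∧ Odd d ∧ 5 ≤ c ∧ 5 ≤ d ∧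
      G = {1, 3, a, b, c, d}) ↔
      G.count 1 = 1 ∧ G.count 2 = 0 ∧ G.count 3 = 1 ∧ G.count 4 = 0 ∧ G.countP Even = 2 ∧
        bigOdds G = 3 := by
  constructor
  · rintro ⟨a, b, c, d, h⟩
    simp only [h, bigOdds_cons, bigOdds_zero, Multiset.insert_eq_cons, ← Multiset.cons_zero,
      Multiset.count_cons, Multiset.countP_cons, Multiset.count_zero, Multiset.countP_zero]
    and_intros <;> grind
  · intro h
    have hsum := card_eq_count_add G hG
    obtain ⟨G, rfl⟩ := Multiset.exists_cons_of_mem (Multiset.count_ne_zero.1 (by omega) : 3 ∈ G)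
    simp [show Odd 3 by decide, show ¬ Even 3 by decide] at h hsum hcard hG
    obtain ⟨B, C, hBC, hB, hC, hB', hC'⟩ := exists_eq_replicate_add G (by simpa using hG)
    rw [show G.count 1 = 1 by omega] at hBC
    obtain ⟨a, b, rfl⟩ := Multiset.card_eq_two.1 (show B.card = 2 by omega)
    obtain ⟨c, d, rfl⟩ := Multiset.card_eq_two.1 (show C.card = 2 by omega)
    simp only [Multiset.insert_eq_cons, Multiset.mem_cons, Multiset.mem_singleton,
      forall_eq_or_imp, forall_eq] at hB' hC'
    refine ⟨a, b, c, d, ?_⟩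
    and_intros
    on_goal 9 =>
      rw [hBC]
      exact Multiset.cons_swap 3 1 {a, b, c, d}
    all_goals
      clear hBC
      grind

theorem exists_two_three_three_even_iff {G : Multiset ℕ} (hG : 0 ∉ G) (hcard : G.card = 6) :
    (∃ a b c d, Even a ∧ Even b ∧ Even c ∧ 6 ≤ a ∧ 6 ≤ b ∧ 6 ≤ c ∧ Odd d ∧ 5 ≤ d ∧
      G = {2, 3, a, b, c, d}) ↔
      G.count 2 = 1 ∧ G.count 3 = 1 ∧ G.count 4 = 0 ∧ G.countP Even = 4 ∧ bigOdds G = 2 := by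
  constructor
  · rintro ⟨a, b, c, d, h⟩
    simp only [h, bigOdds_cons, bigOdds_zero, Multiset.insert_eq_cons, ← Multiset.cons_zero,
      Multiset.count_cons, Multiset.countP_cons, Multiset.count_zero, Multiset.countP_zero]
    and_intros <;> grind
  · intro h
    have hsum := card_eq_count_add G hG
    obtain ⟨G, rfl⟩ := Multiset.exists_cons_of_mem (Multiset.count_ne_zero.1 (by omega) : 2 ∈ G)
    obtain ⟨G, rfl⟩ := Multiset.exists_cons_of_mem ((Multiset.mem_cons.1
      (Multiset.count_ne_zero.1 (by omega) : 3 ∈ 2 ::ₘ G)).resolve_left (by simp))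
    simp [show Odd 3 by decide, show ¬ Even 3 by decide] at h hsum hcard hG
    obtain ⟨B, C, hBC, hB, hC, hB', hC'⟩ := exists_eq_replicate_add G (by simpa using hG)
    rw [show G.count 1 = 0 by omega] at hBC
    obtain ⟨a, b, c, rfl⟩ := Multiset.card_eq_three.1 (show B.card = 3 by omega)
    obtain ⟨d, rfl⟩ := Multiset.card_eq_one.1 (show C.card = 1 by omega)
    simp only [Multiset.insert_eq_cons, Multiset.mem_cons, Multiset.mem_singleton,
      forall_eq_or_imp, forall_eq] at hB' hC'
    refine ⟨a, b, c, d, ?_⟩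
    and_intros
    on_goal 9 =>
      rw [hBC]
      rfl
    all_goals
      clear hBC
      grind

theorem exists_two_three_odd_iff {G : Multiset ℕ} (hG : 0 ∉ G) (hcard : G.card = 6) :
    (∃ a b c d e, Even a ∧ Even b ∧ Odd c ∧ Odd d ∧ Odd e ∧ 3 ≤ c ∧ 3 ≤ d ∧ 3 ≤ e ∧
      G = {2, a, b, c, d, e}) ↔ G.count 2 ≠ 0 ∧ G.countP Even = 3 ∧ bigOdds G = 3 := by
  constructor
  · rintro ⟨a, b, c, d, e, h⟩
    simp only [h, bigOdds_cons, bigOdds_zero, Multiset.insert_eq_cons, ← Multiset.cons_zero,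
      Multiset.count_cons, Multiset.countP_cons, Multiset.count_zero, Multiset.countP_zero]
    and_intros <;> grind
  · intro h
    have hsum := card_eq_count_add G hG
    obtain ⟨G, rfl⟩ := Multiset.exists_cons_of_mem (Multiset.count_ne_zero.1 (by omega) : 2 ∈ G)
    simp at h hsum hcard hG
    obtain ⟨B, C, hBC, hB, hC, hB', hC'⟩ := exists_eq_replicate_add G (by simpa using hG)
    rw [show G.count 1 = 0 by omega] at hBC
    obtain ⟨a, b, rfl⟩ := Multiset.card_eq_two.1 (show B.card = 2 by omega)
    obtain ⟨c, d, e, rfl⟩ := Multiset.card_eq_three.1 (show C.card = 3 by omega)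
    simp only [Multiset.insert_eq_cons, Multiset.mem_cons, Multiset.mem_singleton,
      forall_eq_or_imp, forall_eq] at hB' hC'
    refine ⟨a, b, c, d, e, ?_⟩
    and_intros
    on_goal 9 =>
      rw [hBC]
      rfl
    all_goals
      clear hBC
      grind

theorem exists_two_three_two_even_iff {G : Multiset ℕ} (hG : 0 ∉ G) (hcard : G.card = 6) :
    (∃ a b c d, Even a ∧ Even b ∧ 6 ≤ a ∧ 6 ≤ b ∧ Odd c ∧ Odd d ∧ 5 ≤ c ∧ 5 ≤ d ∧
      G = {2, 3, a, b, c, d}) ↔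
      G.count 2 = 1 ∧ G.count 3 = 1 ∧ G.count 4 = 0 ∧ G.countP Even = 3 ∧ bigOdds G = 3 := by
  constructor
  · rintro ⟨a, b, c, d, h⟩
    simp only [h, bigOdds_cons, bigOdds_zero, Multiset.insert_eq_cons, ← Multiset.cons_zero,
      Multiset.count_cons, Multiset.countP_cons, Multiset.count_zero, Multiset.countP_zero]
    and_intros <;> grind
  · intro h
    have hsum := card_eq_count_add G hG
    obtain ⟨G, rfl⟩ := Multiset.exists_cons_of_mem (Multiset.count_ne_zero.1 (by omega) : 2 ∈ G)
    obtain ⟨G, rfl⟩ := Multiset.exists_cons_of_mem ((Multiset.mem_cons.1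
      (Multiset.count_ne_zero.1 (by omega) : 3 ∈ 2 ::ₘ G)).resolve_left (by simp))
    simp [show Odd 3 by decide, show ¬ Even 3 by decide] at h hsum hcard hG
    obtain ⟨B, C, hBC, hB, hC, hB', hC'⟩ := exists_eq_replicate_add G (by simpa using hG)
    rw [show G.count 1 = 0 by omega] at hBC
    obtain ⟨a, b, rfl⟩ := Multiset.card_eq_two.1 (show B.card = 2 by omega)
    obtain ⟨c, d, rfl⟩ := Multiset.card_eq_two.1 (show C.card = 2 by omega)
    simp only [Multiset.insert_eq_cons, Multiset.mem_cons, Multiset.mem_singleton,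
      forall_eq_or_imp, forall_eq] at hB' hC'
    refine ⟨a, b, c, d, ?_⟩
    and_intros
    on_goal 9 =>
      rw [hBC]
      rfl
    all_goals
      clear hBC
      grind

theorem exists_four_even_iff {G : Multiset ℕ} (hG : 0 ∉ G) (hcard : G.card = 6) :
    (∃ a b c d e f, Even a ∧ Even b ∧ Even c ∧ Even d ∧ 4 ≤ a ∧ 4 ≤ b ∧ 4 ≤ c ∧ 4 ≤ d ∧
        Odd e ∧ Odd f ∧ 3 ≤ e ∧ 3 ≤ f ∧
      G = {a, b, c, d, e, f}) ↔ G.count 2 = 0 ∧ G.countP Even = 4 ∧ bigOdds G = 2 := by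
  constructor
  · rintro ⟨a, b, c, d, e, f, h⟩
    simp only [h, bigOdds_cons, bigOdds_zero, Multiset.insert_eq_cons, ← Multiset.cons_zero,
      Multiset.count_cons, Multiset.countP_cons, Multiset.count_zero, Multiset.countP_zero]
    and_intros <;> grind
  · intro h
    have hsum := card_eq_count_add G hG
    obtain ⟨B, C, hBC, hB, hC, hB', hC'⟩ := exists_eq_replicate_add G hG
    rw [show G.count 1 = 0 by omega] at hBC
    obtain ⟨a, b, c, d, rfl⟩ := card_eq_four (show B.card = 4 by omega)
    obtain ⟨e, f, rfl⟩ := Multiset.card_eq_two.1 (show C.card = 2 by omega)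
    have h2 : 2 ∉ G := Multiset.count_eq_zero.1 h.1
    simp only [Multiset.insert_eq_cons, Multiset.mem_cons, Multiset.mem_singleton,
      forall_eq_or_imp, forall_eq] at hB' hC'
    refine ⟨a, b, c, d, e, f, ?_⟩
    and_intros
    on_goal 13 =>
      rw [hBC]
      rfl
    all_goals
      clear hBC
      grind

theorem exists_one_even_iff {G : Multiset ℕ} (hG : 0 ∉ G) (hcard : G.card = 6) :
    (∃ a b c d e f, Even a ∧ Odd b ∧ Odd c ∧ Odd d ∧ Odd e ∧ Odd f ∧
        3 ≤ b ∧ 3 ≤ c ∧ 3 ≤ d ∧ 3 ≤ e ∧ 3 ≤ f ∧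
      G = {a, b, c, d, e, f}) ↔ G.countP Even = 1 ∧ bigOdds G = 5 := by
  constructor
  · rintro ⟨a, b, c, d, e, f, h⟩
    simp only [h, bigOdds_cons, bigOdds_zero, Multiset.insert_eq_cons, ← Multiset.cons_zero,
      Multiset.countP_cons, Multiset.countP_zero]
    and_intros <;> grind
  · intro h
    have hsum := card_eq_count_add G hG
    obtain ⟨B, C, hBC, hB, hC, hB', hC'⟩ := exists_eq_replicate_add G hG
    rw [show G.count 1 = 0 by omega] at hBC
    obtain ⟨a, rfl⟩ := Multiset.card_eq_one.1 (show B.card = 1 by omega)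
    obtain ⟨b, c, d, e, f, rfl⟩ := card_eq_five (show C.card = 5 by omega)
    simp only [Multiset.insert_eq_cons, Multiset.mem_cons, Multiset.mem_singleton,
      forall_eq_or_imp, forall_eq] at hB' hC'
    refine ⟨a, b, c, d, e, f, ?_⟩
    and_intros
    on_goal 12 =>
      rw [hBC]
      rfl
    all_goals
      clear hBC
      grind

theorem forall_even_iff (G : Multiset ℕ) :
    (∀ p ∈ G, Even p) ↔ G.count 1 = 0 ∧ bigOdds G = 0 := by
  rw [Multiset.count_eq_zero, bigOdds, Multiset.countP_eq_zero]
  exact ⟨fun h => ⟨fun h1 => by simpa using h 1 h1, by grind⟩, by grind⟩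

/-- In Version B, the classification of P-positions with exactly six piles. -/
theorem versionB_six_piles (G : Multiset ℕ) (hG : 0 ∉ G)
    (hcard : Multiset.card G = 6) :
    PPosB G ↔
      (∃ a b, Even a ∧ Even b ∧ G = {1, 1, 1, 1, a, b}) ∨
      (∃ a b c d, Even a ∧ Even b ∧ Even c ∧ Even d ∧ G = {1, 1, a, b, c, d}) ∨
      (∃ a b c d, Even a ∧ Odd b ∧ Odd c ∧ Odd d ∧ 3 ≤ b ∧ 3 ≤ c ∧ 3 ≤ d ∧
        G = {1, 1, a, b, c, d}) ∨
      (∃ a b c d, Even a ∧ Even b ∧ Even c ∧ 4 ≤ a ∧ 4 ≤ b ∧ 4 ≤ c ∧ Odd d ∧ 3 ≤ d ∧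
        G = {1, 2, a, b, c, d}) ∨
      (∃ a b c d, Even a ∧ Even b ∧ 6 ≤ a ∧ 6 ≤ b ∧ Odd c ∧ Odd d ∧ 5 ≤ c ∧ 5 ≤ d ∧
        G = {1, 3, a, b, c, d}) ∨
      (∃ a b c d, Even a ∧ Even b ∧ Even c ∧ 6 ≤ a ∧ 6 ≤ b ∧ 6 ≤ c ∧ Odd d ∧ 5 ≤ d ∧
        G = {2, 3, a, b, c, d}) ∨
      ((∃ a b c d e, Even a ∧ Even b ∧ Odd c ∧ Odd d ∧ Odd e ∧ 3 ≤ c ∧ 3 ≤ d ∧ 3 ≤ e ∧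
          G = {2, a, b, c, d, e}) ∧
        ¬ (∃ a b c d, Even a ∧ Even b ∧ 6 ≤ a ∧ 6 ≤ b ∧ Odd c ∧ Odd d ∧ 5 ≤ c ∧ 5 ≤ d ∧
            G = {2, 3, a, b, c, d})) ∨
      (∀ p ∈ G, Even p) ∨
      (∃ a b c d e f, Even a ∧ Even b ∧ Even c ∧ Even d ∧ 4 ≤ a ∧ 4 ≤ b ∧ 4 ≤ c ∧ 4 ≤ d ∧
        Odd e ∧ Odd f ∧ 3 ≤ e ∧ 3 ≤ f ∧ G = {a, b, c, d, e, f}) ∨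
      (∃ a b c d e f, Even a ∧ Odd b ∧ Odd c ∧ Odd d ∧ Odd e ∧ Odd f ∧
        3 ≤ b ∧ 3 ≤ c ∧ 3 ≤ d ∧ 3 ≤ e ∧ 3 ≤ f ∧ G = {a, b, c, d, e, f}) := by
  rw [(pPosB_iff_and_nPosB_iff G hG hcard.le).1,
    exists_four_ones_iff hG hcard,
    exists_two_ones_four_even_iff hG hcard,
    exists_two_ones_one_even_iff hG,
    exists_one_two_iff hG hcard,
    exists_one_three_iff hG hcard,
    exists_two_three_three_even_iff hG hcard,
    exists_two_three_odd_iff hG hcard,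
    exists_two_three_two_even_iff hG hcard,
    exists_four_even_iff hG hcard,
    exists_one_even_iff hG hcard,
    forall_even_iff G]
  have hsum := card_eq_count_add G hG
  unfold HasPPattern PPattern
  generalize G.count 1 = n₁, G.count 2 = n₂, G.count 3 = n₃, G.count 4 = n₄, G.countP Even = e,
    bigOdds G = o at *
  clear hG
  obtain rfl : o = 6 - (n₁ + e) := by omega
  have : n₁ < 7 := by omega
  have : e < 7 - n₁ := by omega
  interval_cases n₁ <;> interval_cases e <;> simp
  all_goals omega
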